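/- (Convergence rate of entropy-regularized Frank-Wolfe in the convex case.) Under the setup of the entropy-regularized Frank-Wolfe algorithm, assume additionally that B is positive semidefinite (B(Z,Z) ≥ 0 for all Z), so that J, and hence F = J + λH, is convex. Let X* ∈ D_n be a minimizer of F over D_n. Then for every T ≥ 1, F(X_T) − F(X*) ≤ 4L/(n(T+1)). -/

import Mathlib

/-- `D_n`: nonnegative matrices with every row and column sum equal to `1/n`. -/
def Dset (n : ℕ) : Set (Matrix (Fin n) (Fin n) ℝ) :=
  {X | (∀ i j, 0 ≤ X i j) ∧ (∀ i, ∑ j, X i j = 1 / (n : ℝ)) ∧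
    (∀ j, ∑ i, X i j = 1 / (n : ℝ))}

/-- Frobenius inner product of real matrices. -/
def frob {n : ℕ} (A B : Matrix (Fin n) (Fin n) ℝ) : ℝ :=
  ∑ i, ∑ j, A i j * B i j

/-- Negative entropy `H(X) = ∑ i j, X i j * log (X i j)` (with `0 log 0 = 0`). -/
noncomputable def negEntropy {n : ℕ} (X : Matrix (Fin n) (Fin n) ℝ) : ℝ :=
  ∑ i, ∑ j, X i j * Real.log (X i j)

/-- `⟨∇J(X), Y⟩_F = B(X,Y) + ⟨C,Y⟩_F` for `J(X) = ½ B(X,X) + ⟨C,X⟩_F`. -/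
def gradTerm {n : ℕ}
    (B : Matrix (Fin n) (Fin n) ℝ →ₗ[ℝ] Matrix (Fin n) (Fin n) ℝ →ₗ[ℝ] ℝ)
    (C X Y : Matrix (Fin n) (Fin n) ℝ) : ℝ :=
  B X Y + frob C Y

/-- `F(X) = J(X) + λ H(X)` where `J(X) = ½ B(X,X) + ⟨C,X⟩_F`. -/
noncomputable def Ffun {n : ℕ}
    (B : Matrix (Fin n) (Fin n) ℝ →ₗ[ℝ] Matrix (Fin n) (Fin n) ℝ →ₗ[ℝ] ℝ)
    (C : Matrix (Fin n) (Fin n) ℝ) (lam : ℝ) (X : Matrix (Fin n) (Fin n) ℝ) : ℝ :=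
  (1 / 2 : ℝ) * B X X + frob C X + lam * negEntropy X

/-- The gap function
`g(X) = ⟨∇J(X), X⟩_F + λH(X) − min_{Y ∈ D_n} (⟨∇J(X), Y⟩_F + λH(Y))`. -/
noncomputable def gapFun {n : ℕ}
    (B : Matrix (Fin n) (Fin n) ℝ →ₗ[ℝ] Matrix (Fin n) (Fin n) ℝ →ₗ[ℝ] ℝ)
    (C : Matrix (Fin n) (Fin n) ℝ) (lam : ℝ) (X : Matrix (Fin n) (Fin n) ℝ) : ℝ :=
  gradTerm B C X X + lam * negEntropy X
    - sInf ((fun Y => gradTerm B C X Y + lam * negEntropy Y) '' Dset n)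

theorem enfw_negEntropy_conv {n : ℕ} {X Y : Matrix (Fin n) (Fin n) ℝ} (hX : X ∈ Dset n)
    (hY : Y ∈ Dset n) {s : ℝ} (h0 : 0 ≤ s) (h1 : s ≤ 1) :
    negEntropy (X + s • (Y - X)) ≤ negEntropy X + s * (negEntropy Y - negEntropy X) := by
  have key : negEntropy (X + s • (Y - X)) ≤ (1 - s) * negEntropy X + s * negEntropy Y := by
    unfold negEntropy
    simp only [Finset.mul_sum, ← Finset.sum_add_distrib]
    refine Finset.sum_le_sum fun i _ => Finset.sum_le_sum fun j _ => ?_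
    have h := Real.convexOn_mul_log.2 (Set.mem_Ici.2 (hX.1 i j)) (Set.mem_Ici.2 (hY.1 i j))
      (show 0 ≤ 1 - s by linarith) h0 (by ring)
    have e : (X + s • (Y - X)) i j = (1 - s) * X i j + s * Y i j := by
      simp; ring
    rw [e]
    simpa only [smul_eq_mul] using h
  linarith

theorem enfw_mem {n : ℕ} {X Y : Matrix (Fin n) (Fin n) ℝ} (hX : X ∈ Dset n)
    (hY : Y ∈ Dset n) {s : ℝ} (h0 : 0 ≤ s) (h1 : s ≤ 1) : X + s • (Y - X) ∈ Dset n := by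
  have e : ∀ i j, (X + s • (Y - X)) i j = (1 - s) * X i j + s * Y i j := by
    intro i j
    simp; ring
  refine ⟨fun i j => ?_, fun i => ?_, fun j => ?_⟩
  · rw [e]
    have := hX.1 i j
    have := hY.1 i j
    have : 0 ≤ 1 - s := by linarith
    positivity
  · simp only [e, Finset.sum_add_distrib, ← Finset.mul_sum, hX.2.1, hY.2.1]; ring
  · simp only [e, Finset.sum_add_distrib, ← Finset.mul_sum, hX.2.2, hY.2.2]; ring

theorem enfw_diam {n : ℕ} (hn : 1 ≤ n) {X Y : Matrix (Fin n) (Fin n) ℝ} (hX : X ∈ Dset n)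
    (hY : Y ∈ Dset n) : ∑ i, ∑ j, ((Y - X) i j) ^ 2 ≤ 2 / (n : ℝ) := by
  have hn' : (0 : ℝ) < n := by exact_mod_cast hn
  have le : ∀ {Z : Matrix (Fin n) (Fin n) ℝ}, Z ∈ Dset n → ∀ i j, Z i j ≤ 1 / (n : ℝ) := by
    intro Z hZ i j
    rw [← hZ.2.1 i]
    exact Finset.single_le_sum (f := fun j => Z i j) (fun k _ => hZ.1 i k) (Finset.mem_univ j)
  have tot : ∀ {Z : Matrix (Fin n) (Fin n) ℝ}, Z ∈ Dset n → ∑ i, ∑ j, Z i j = 1 := by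
    intro Z hZ
    simp only [hZ.2.1]
    simp
    field_simp
  calc ∑ i, ∑ j, ((Y - X) i j) ^ 2
      ≤ ∑ i, ∑ j, (1 / (n : ℝ) * X i j + 1 / (n : ℝ) * Y i j) := by
        refine Finset.sum_le_sum fun i _ => Finset.sum_le_sum fun j _ => ?_
        rw [Matrix.sub_apply]
        have a := mul_le_mul_of_nonneg_right (le hX i j) (hX.1 i j)
        have b := mul_le_mul_of_nonneg_right (le hY i j) (hY.1 i j)
        have c := mul_nonneg (hX.1 i j) (hY.1 i j)
        nlinarith
    _ = 2 / (n : ℝ) := by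
        simp only [Finset.sum_add_distrib, ← Finset.mul_sum, tot hX, tot hY]; ring

theorem enfw_frob_step {n : ℕ} (C X Y : Matrix (Fin n) (Fin n) ℝ) (s : ℝ) :
    frob C (X + s • (Y - X)) = frob C X + s * (frob C Y - frob C X) := by
  have : frob C (X + s • (Y - X)) = (1 - s) * frob C X + s * frob C Y := by
    unfold frob
    simp only [Finset.mul_sum, ← Finset.sum_add_distrib]
    refine Finset.sum_congr rfl fun i _ => Finset.sum_congr rfl fun j _ => ?_
    simp; ring
  rw [this]; ring

theorem enfw_step_opt {g q s γ : ℝ} (hg : 0 ≤ g) (hq : 0 ≤ q)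
    (hs : s = if (1 / 2 : ℝ) * q ≤ 0 then 1 else min (g / (2 * ((1 / 2 : ℝ) * q))) 1)
    (h0 : 0 ≤ γ) (h1 : γ ≤ 1) :
    0 ≤ s ∧ s ≤ 1 ∧ -s * g + s ^ 2 * q / 2 ≤ -γ * g + γ ^ 2 * q / 2 := by
  split_ifs at hs with h
  · have : q = 0 := by linarith
    subst hs this
    refine ⟨by norm_num, le_rfl, by nlinarith⟩
  · have hq' : 0 < q := by linarith
    have e : 2 * ((1 / 2 : ℝ) * q) = q := by ring
    rw [e] at hs
    rcases le_total g q with hgq | hgq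
    · rw [min_eq_left ((div_le_one hq').2 hgq)] at hs
      have hs0 : 0 ≤ s := by rw [hs]; positivity
      have hs1 : s ≤ 1 := by rw [hs]; exact (div_le_one hq').2 hgq
      have : g = s * q := by rw [hs]; field_simp
      refine ⟨hs0, hs1, ?_⟩
      rw [this]
      nlinarith [mul_nonneg hq (sq_nonneg (γ - s))]
    · rw [min_eq_right ((one_le_div hq').2 hgq)] at hs
      subst hs
      refine ⟨by norm_num, le_rfl, ?_⟩
      nlinarith [mul_nonneg (sub_nonneg.2 h1) (sub_nonneg.2 hgq),
        mul_nonneg hq (sq_nonneg (1 - γ))]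

/-- Convergence rate of entropy-regularized Frank-Wolfe in the convex case: if the
bilinear form `B` is positive semidefinite (so `J`, hence `F = J + λH`, is convex)
and `X*` minimizes `F` over `D_n`, then `F(X_T) − F(X*) ≤ 4L/(n(T+1))` for `T ≥ 1`. -/
theorem enfw_convergence_convex {n : ℕ} (hn : 1 ≤ n) {lam : ℝ} (hlam : 0 < lam)
    (B : Matrix (Fin n) (Fin n) ℝ →ₗ[ℝ] Matrix (Fin n) (Fin n) ℝ →ₗ[ℝ] ℝ)
    (hBsymm : ∀ Z W, B Z W = B W Z) (L : ℝ) (hL : 0 < L)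
    (hBL : ∀ Z : Matrix (Fin n) (Fin n) ℝ, |B Z Z| ≤ L * ∑ i, ∑ j, (Z i j) ^ 2)
    (hBpsd : ∀ Z : Matrix (Fin n) (Fin n) ℝ, 0 ≤ B Z Z)
    (C : Matrix (Fin n) (Fin n) ℝ)
    (X Y : ℕ → Matrix (Fin n) (Fin n) ℝ) (s : ℕ → ℝ)
    (hX0 : X 0 ∈ Dset n)
    (hYmem : ∀ t, Y t ∈ Dset n)
    (hYmin : ∀ t, ∀ Y' ∈ Dset n,
      gradTerm B C (X t) (Y t) + lam * negEntropy (Y t)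
        ≤ gradTerm B C (X t) Y' + lam * negEntropy Y')
    (hs : ∀ t, s t =
      if (1 / 2 : ℝ) * B (Y t - X t) (Y t - X t) ≤ 0 then 1
      else min (gapFun B C lam (X t)
        / (2 * ((1 / 2 : ℝ) * B (Y t - X t) (Y t - X t)))) 1)
    (hupd : ∀ t, X (t + 1) = X t + s t • (Y t - X t))
    (Xstar : Matrix (Fin n) (Fin n) ℝ) (hXstar : Xstar ∈ Dset n)
    (hXstarMin : ∀ Z ∈ Dset n, Ffun B C lam Xstar ≤ Ffun B C lam Z) :
    ∀ T : ℕ, 1 ≤ T →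
      Ffun B C lam (X T) - Ffun B C lam Xstar
        ≤ 4 * L / ((n : ℝ) * ((T : ℝ) + 1)) := by
  have hn' : (0 : ℝ) < n := by exact_mod_cast hn
  have hgap : ∀ t, gapFun B C lam (X t) = gradTerm B C (X t) (X t) + lam * negEntropy (X t)
      - (gradTerm B C (X t) (Y t) + lam * negEntropy (Y t)) := by
    intro t
    unfold gapFun
    congr 1
    apply IsLeast.csInf_eq
    refine ⟨⟨Y t, hYmem t, rfl⟩, ?_⟩
    rintro _ ⟨Z, hZ, rfl⟩
    exact hYmin t Z hZ
  have hgh : ∀ t, Ffun B C lam (X t) - Ffun B C lam Xstar ≤ gapFun B C lam (X t) := by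
    intro t
    rw [hgap]
    have h1 := hYmin t Xstar hXstar
    have h2 := hBpsd (X t - Xstar)
    simp only [map_sub, LinearMap.sub_apply] at h2
    rw [hBsymm Xstar (X t)] at h2
    unfold gradTerm at *
    unfold Ffun
    linarith
  have step : ∀ t, X t ∈ Dset n → X (t + 1) ∈ Dset n ∧ ∀ γ : ℝ, 0 ≤ γ → γ ≤ 1 →
      Ffun B C lam (X (t + 1)) - Ffun B C lam Xstar ≤
        (1 - γ) * (Ffun B C lam (X t) - Ffun B C lam Xstar) + γ ^ 2 * (L / n) := by
    intro t ht
    have hg0 : 0 ≤ gapFun B C lam (X t) := by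
      have := hgh t
      have := hXstarMin _ ht
      linarith
    have hq := hBpsd (Y t - X t)
    have hopt := fun γ h0 h1 => enfw_step_opt (γ := γ) hg0 hq (hs t) h0 h1
    obtain ⟨s0, s1, -⟩ := hopt 0 le_rfl zero_le_one
    refine ⟨by rw [hupd]; exact enfw_mem ht (hYmem t) s0 s1, fun γ h0 h1 => ?_⟩
    obtain ⟨-, -, ho⟩ := hopt γ h0 h1
    have hK : B (Y t - X t) (Y t - X t) ≤ 2 * (L / n) := by
      have a := (le_abs_self _).trans (hBL (Y t - X t))
      have b := mul_le_mul_of_nonneg_left (enfw_diam hn ht (hYmem t)) hL.le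
      calc _ ≤ _ := a
        _ ≤ _ := b
        _ = _ := by ring
    have hF : Ffun B C lam (X (t + 1)) ≤ Ffun B C lam (X t) - s t * gapFun B C lam (X t)
        + (s t) ^ 2 * B (Y t - X t) (Y t - X t) / 2 := by
      rw [hgap, hupd]
      have hH := mul_le_mul_of_nonneg_left (enfw_negEntropy_conv ht (hYmem t) s0 s1) hlam.le
      unfold Ffun gradTerm
      rw [enfw_frob_step]
      simp only [map_sub, map_add, map_smul, LinearMap.sub_apply, LinearMap.add_apply,
        LinearMap.smul_apply, smul_eq_mul]
      rw [hBsymm (Y t) (X t)]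
      linarith
    have h3 := mul_le_mul_of_nonneg_left hK (sq_nonneg γ)
    have h4 := mul_le_mul_of_nonneg_left (hgh t) h0
    linarith
  have hmem : ∀ t, X t ∈ Dset n := by
    intro t
    induction t with
    | zero => exact hX0
    | succ k ih => exact (step k ih).1
  have hK0 : 0 < L / n := by positivity
  intro T hT
  have e : 4 * L / ((n : ℝ) * ((T : ℝ) + 1)) = 4 * (L / n) / ((T : ℝ) + 1) := by
    field_simp
  rw [e]
  clear e
  induction T, hT using Nat.le_induction with
  | base =>
    have := (step 0 (hmem 0)).2 1 zero_le_one le_rfl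
    norm_num at this ⊢
    linarith
  | succ t ht ih =>
    have ht0 : (0 : ℝ) ≤ t := by positivity
    have h := (step t (hmem t)).2 (2 / ((t : ℝ) + 2)) (by positivity)
      (by rw [div_le_one (by positivity)]; linarith)
    have e1 : 1 - 2 / ((t : ℝ) + 2) = t / (t + 2) := by field_simp; ring
    rw [e1] at h
    have h5 := mul_le_mul_of_nonneg_left ih (show 0 ≤ (t : ℝ) / (t + 2) by positivity)
    refine h.trans ((add_le_add_left h5 _).trans ?_)
    push_cast
    have e2 : 4 * (L / n) / ((t : ℝ) + 1 + 1) - ((t : ℝ) / (t + 2) * (4 * (L / n) / (t + 1))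
        + (2 / ((t : ℝ) + 2)) ^ 2 * (L / n)) = 4 * (L / n) / ((t + 1) * (t + 2) ^ 2) := by
      rw [show (t : ℝ) + 1 + 1 = t + 2 by ring]
      field_simp
      ring
    have : 0 ≤ 4 * (L / n) / (((t : ℝ) + 1) * (t + 2) ^ 2) := by positivity
    linarith
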